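/- For every finite bipartite graph G, ker(G) = core(G), i.e., the intersection of all critical independent sets equals the intersection of all maximum independent sets. -/

import Mathlib

open Finset

open scoped Classical

variable {V : Type*} [Fintype V] [DecidableEq V]

/-- The neighborhood `N(X)` of a finite set of vertices `X`. -/
noncomputable def nbr (G : SimpleGraph V) (X : Finset V) : Finset V :=
  Finset.univ.filter fun v => ∃ x ∈ X, G.Adj v x

/-- The difference `d(X) = |X| - |N(X)|` of a set of vertices. -/
noncomputable def diffZ (G : SimpleGraph V) (X : Finset V) : ℤ :=
  (X.card : ℤ) - ((nbr G X).card : ℤ)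

/-- The critical difference `d_c(G) = max {d(X) : X ⊆ V}`. -/
noncomputable def critDiff (G : SimpleGraph V) : ℤ :=
  (Finset.univ : Finset V).powerset.sup' (Finset.powerset_nonempty _) (diffZ G)

/-- A set of vertices is independent if no two of its vertices are adjacent. -/
def IsIndep (G : SimpleGraph V) (S : Finset V) : Prop :=
  ∀ u ∈ S, ∀ v ∈ S, ¬ G.Adj u v

/-- The independence number `α(G)`. -/
noncomputable def indepNum (G : SimpleGraph V) : ℕ :=
  ((Finset.univ : Finset V).powerset.filter (IsIndep G)).sup Finset.card

/-- The critical independence difference `id_c(G) = max {d(I) : I independent}`. -/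
noncomputable def idc (G : SimpleGraph V) : ℤ :=
  ((Finset.univ : Finset V).powerset.filter (IsIndep G)).sup'
    ⟨∅, by simp [IsIndep]⟩ (diffZ G)

/-- A critical independent set: an independent set `S` with `d(S) = id_c(G)`. -/
def CritIndep (G : SimpleGraph V) (S : Finset V) : Prop :=
  IsIndep G S ∧ diffZ G S = idc G

/-- A finite set of edges of `G` that are pairwise non-incident (a matching). -/
def IsMatchingSet (G : SimpleGraph V) (M : Finset (Sym2 V)) : Prop :=
  (∀ e ∈ M, e ∈ G.edgeSet) ∧
    (M : Set (Sym2 V)).Pairwise fun e f => ∀ v : V, ¬(v ∈ e ∧ v ∈ f)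

/-- The matching number `μ(G)`. -/
noncomputable def matchNum (G : SimpleGraph V) : ℕ :=
  ((Finset.univ : Finset (Sym2 V)).powerset.filter (IsMatchingSet G)).sup Finset.card

/-- A maximum independent set. -/
def IsMaxIndep (G : SimpleGraph V) (S : Finset V) : Prop :=
  IsIndep G S ∧ S.card = indepNum G

/-- `ker(G)`: the intersection of all critical independent sets. -/
noncomputable def kerSet (G : SimpleGraph V) : Finset V :=
  Finset.univ.filter fun v => ∀ S : Finset V, CritIndep G S → v ∈ S

/-- `diadem(G)`: the union of all critical independent sets. -/
noncomputable def diademSet (G : SimpleGraph V) : Finset V :=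
  Finset.univ.filter fun v => ∃ S : Finset V, CritIndep G S ∧ v ∈ S

/-- `core(G)`: the intersection of all maximum independent sets. -/
noncomputable def coreSet (G : SimpleGraph V) : Finset V :=
  Finset.univ.filter fun v => ∀ S : Finset V, IsMaxIndep G S → v ∈ S

/-- `corona(G)`: the union of all maximum independent sets. -/
noncomputable def coronaSet (G : SimpleGraph V) : Finset V :=
  Finset.univ.filter fun v => ∃ S : Finset V, IsMaxIndep G S ∧ v ∈ S

/-- `δ₀(A) = max {δ(X) : X ⊆ A}`, the maximum deficiency over subsets of a side. -/
noncomputable def delta0 (G : SimpleGraph V) (A : Finset V) : ℤ :=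
  A.powerset.sup' (Finset.powerset_nonempty _) (diffZ G)

/-- An `A`-critical set: a subset `X ⊆ A` with `δ(X) = δ₀(A)`. -/
def SideCrit (G : SimpleGraph V) (A X : Finset V) : Prop :=
  X ⊆ A ∧ diffZ G X = delta0 G A

/-- `ker_A(G)`: the intersection of all `A`-critical sets. -/
noncomputable def kerSide (G : SimpleGraph V) (A : Finset V) : Finset V :=
  Finset.univ.filter fun v => ∀ X : Finset V, SideCrit G A X → v ∈ X

/-- `diadem_A(G)`: the union of all `A`-critical sets. -/
noncomputable def diademSide (G : SimpleGraph V) (A : Finset V) : Finset V :=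
  Finset.univ.filter fun v => ∃ X : Finset V, SideCrit G A X ∧ v ∈ X

/-- `{A, B}` is a bipartition of `G`: both sides nonempty, disjoint, covering all
vertices, and every edge goes between `A` and `B`. -/
def IsBipartition (G : SimpleGraph V) (A B : Finset V) : Prop :=
  A.Nonempty ∧ B.Nonempty ∧ Disjoint A B ∧ A ∪ B = Finset.univ ∧
    ∀ u v : V, G.Adj u v → (u ∈ A ∧ v ∈ B) ∨ (u ∈ B ∧ v ∈ A)

theorem IsBipartition.symm {G : SimpleGraph V} {A B : Finset V} (h : IsBipartition G A B) :
    IsBipartition G B A := by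
  obtain ⟨hA, hB, hd, hu, hadj⟩ := h
  exact ⟨hB, hA, hd.symm, by rw [union_comm, hu], fun u v huv => (hadj u v huv).symm⟩

theorem IsBipartition.nbr_subset {G : SimpleGraph V} {A B X : Finset V}
    (h : IsBipartition G A B) (hX : X ⊆ A) : nbr G X ⊆ B := by
  obtain ⟨-, -, hd, -, hadj⟩ := h
  intro v hv
  obtain ⟨x, hx, hvx⟩ := (mem_filter.1 hv).2
  rcases hadj v x hvx with h | h
  · exact absurd h.2 (disjoint_left.1 hd (hX hx))
  · exact h.1

theorem nbr_union (G : SimpleGraph V) (X Y : Finset V) :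
    nbr G (X ∪ Y) = nbr G X ∪ nbr G Y := by
  ext v
  simp only [nbr, mem_filter, mem_univ, true_and, mem_union]
  grind

theorem IsIndep.card_le_indepNum {G : SimpleGraph V} {S : Finset V} (h : IsIndep G S) :
    S.card ≤ indepNum G :=
  le_sup (f := Finset.card) (by simp [h])

theorem exists_isMaxIndep (G : SimpleGraph V) : ∃ S, IsMaxIndep G S := by
  obtain ⟨S, hS, hcard⟩ := exists_mem_eq_sup
    ((Finset.univ : Finset V).powerset.filter (IsIndep G)) ⟨∅, by simp [IsIndep]⟩ Finset.card
  exact ⟨S, (mem_filter.1 hS).2, hcard.symm⟩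

theorem IsIndep.diffZ_le_idc {G : SimpleGraph V} {S : Finset V} (h : IsIndep G S) :
    diffZ G S ≤ idc G :=
  le_sup' (diffZ G) (by simp [h])

/-- A subset of one side, together with its non-neighbors on the other side, is independent. -/
theorem IsBipartition.isIndep_union_sdiff_nbr {G : SimpleGraph V} {A B X : Finset V}
    (h : IsBipartition G A B) (hX : X ⊆ A) : IsIndep G (X ∪ (B \ nbr G X)) := by
  obtain ⟨-, -, hd, -, hadj⟩ := h
  rw [disjoint_left] at hd
  intro u hu v hv huv
  have hvu := huv.symm
  have := hadj u v huv
  simp only [nbr, mem_union, mem_sdiff, mem_filter, mem_univ, true_and, not_exists,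
    not_and] at hu hv
  grind

theorem IsBipartition.card_union_sdiff_nbr {G : SimpleGraph V} {A B X : Finset V}
    (h : IsBipartition G A B) (hX : X ⊆ A) :
    ((X ∪ (B \ nbr G X)).card : ℤ) = B.card + diffZ G X := by
  have hN := h.nbr_subset hX
  have hle := card_le_card hN
  rw [card_union_of_disjoint (h.2.2.1.mono hX sdiff_subset), card_sdiff_of_subset hN, diffZ]
  omega

theorem IsBipartition.diffZ_le {G : SimpleGraph V} {A B X : Finset V}
    (h : IsBipartition G A B) (hX : X ⊆ A) : B.card + diffZ G X ≤ indepNum G := by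
  rw [← h.card_union_sdiff_nbr hX]
  exact_mod_cast (h.isIndep_union_sdiff_nbr hX).card_le_indepNum

theorem IsBipartition.inter_union_inter {G : SimpleGraph V} {A B : Finset V}
    (h : IsBipartition G A B) (S : Finset V) : S ∩ A ∪ S ∩ B = S := by
  rw [← inter_union_distrib_left, h.2.2.2.1, inter_univ]

theorem IsBipartition.card_le_of_isIndep {G : SimpleGraph V} {A B S : Finset V}
    (h : IsBipartition G A B) (hS : IsIndep G S) :
    (S.card : ℤ) ≤ B.card + diffZ G (S ∩ A) := by
  rw [← h.card_union_sdiff_nbr inter_subset_right]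
  refine Int.ofNat_le.2 (card_le_card ?_)
  conv_lhs => rw [← h.inter_union_inter S]
  refine union_subset_union_right fun v hv => ?_
  obtain ⟨hvS, hvB⟩ := mem_inter.1 hv
  refine mem_sdiff.2 ⟨hvB, fun hvN => ?_⟩
  obtain ⟨x, hx, hvx⟩ := (mem_filter.1 hvN).2
  exact hS v hvS x (mem_inter.1 hx).1 hvx

theorem IsBipartition.diffZ_eq_add {G : SimpleGraph V} {A B : Finset V}
    (h : IsBipartition G A B) (S : Finset V) :
    diffZ G S = diffZ G (S ∩ A) + diffZ G (S ∩ B) := by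
  have hd := h.2.2.1
  conv_lhs => rw [← h.inter_union_inter S]
  rw [diffZ, diffZ, diffZ, nbr_union,
    card_union_of_disjoint (hd.mono inter_subset_right inter_subset_right),
    card_union_of_disjoint (hd.symm.mono (h.nbr_subset inter_subset_right)
      (h.symm.nbr_subset inter_subset_right))]
  push_cast
  ring

theorem IsBipartition.critIndep_of_isMaxIndep {G : SimpleGraph V} {A B S : Finset V}
    (h : IsBipartition G A B) (hS : IsMaxIndep G S) : CritIndep G S := by
  refine ⟨hS.1, le_antisymm hS.1.diffZ_le_idc (sup'_le _ _ fun T _ => ?_)⟩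
  have hA := h.card_le_of_isIndep hS.1
  have hB := h.symm.card_le_of_isIndep hS.1
  have hTA := h.diffZ_le (inter_subset_right (s₁ := T))
  have hTB := h.symm.diffZ_le (inter_subset_right (s₁ := T))
  rw [h.diffZ_eq_add S, h.diffZ_eq_add T]
  rw [hS.2] at hA hB
  linarith

/-- The trace of a critical independent set on a side extends to a maximum independent set by
adding all its non-neighbors on the other side. -/
theorem IsBipartition.isMaxIndep_of_critIndep {G : SimpleGraph V} {A B S : Finset V}
    (h : IsBipartition G A B) (hS : CritIndep G S) :
    IsMaxIndep G (S ∩ A ∪ (B \ nbr G (S ∩ A))) := by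
  refine ⟨h.isIndep_union_sdiff_nbr inter_subset_right, ?_⟩
  obtain ⟨M, hM⟩ := exists_isMaxIndep G
  have hcard := h.card_union_sdiff_nbr (inter_subset_right (s₁ := S))
  have hSA := h.diffZ_le (inter_subset_right (s₁ := S))
  have hSB := h.symm.diffZ_le (inter_subset_right (s₁ := S))
  have hMA := h.card_le_of_isIndep hM.1
  have hMB := h.symm.card_le_of_isIndep hM.1
  have hSd := h.diffZ_eq_add S
  have hMd := h.diffZ_eq_add M
  have hSM := hS.2.trans (h.critIndep_of_isMaxIndep hM).2.symm
  rw [hM.2] at hMA hMB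
  zify
  linarith

theorem IsBipartition.mem_critIndep_of_mem_coreSet {G : SimpleGraph V} {A B S : Finset V} {v : V}
    (h : IsBipartition G A B) (hv : v ∈ coreSet G) (hvA : v ∈ A) (hS : CritIndep G S) :
    v ∈ S := by
  rcases mem_union.1 ((mem_filter.1 hv).2 _ (h.isMaxIndep_of_critIndep hS)) with hv | hv
  · exact (mem_inter.1 hv).1
  · exact absurd (mem_sdiff.1 hv).1 (disjoint_left.1 h.2.2.1 hvA)

/-- For every finite bipartite graph, `ker(G) = core(G)`. -/
theorem kerSet_eq_coreSet (G : SimpleGraph V) (A B : Finset V)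
    (hbip : IsBipartition G A B) :
    kerSet G = coreSet G := by
  refine Subset.antisymm (fun v hv => ?_) fun v hv => ?_
  · exact mem_filter.2 ⟨mem_univ v, fun S hS =>
      (mem_filter.1 hv).2 S (hbip.critIndep_of_isMaxIndep hS)⟩
  · refine mem_filter.2 ⟨mem_univ v, fun S hS => ?_⟩
    rcases mem_union.1 (hbip.2.2.2.1 ▸ mem_univ v : v ∈ A ∪ B) with hvA | hvB
    · exact hbip.mem_critIndep_of_mem_coreSet hv hvA hS
    · exact hbip.symm.mem_critIndep_of_mem_coreSet hv hvB hS
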